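/- (Theorem 2.2.) Let ρ > 0 and Π_ρ = [0,1] × [0,ρ]³ × [−ρ,0]. Assume: (a) f : Π_ρ → ℝ is continuous and there is a continuous δ̲_ρ : [0,1] → [0,∞) with f(t,u,v,w,z) ≥ δ̲_ρ(t) for every (t,u,v,w,z) ∈ Π_ρ; (b) H : K̄_ρ → ℝ is continuous and bounded and there is η̲_ρ ≥ 0 with H[u] ≥ η̲_ρ for every u ∈ ∂K_ρ; (c) η̲_ρ + ∫₀¹ δ̲_ρ(s) ds > 0. Then there exist λ_ρ ∈ (0, +∞) and u_ρ ∈ ∂K_ρ such that u_ρ(t) = λ_ρ ( γ(t) H[u_ρ] + ∫₀¹ k(t,s) f(s, u_ρ(s), u_ρ′(s), u_ρ″(s), u_ρ‴(s)) ds ) for all t ∈ [0,1]; i.e., λ_ρ is a positive eigenvalue of the parameter-dependent cantilever BVP with eigenfunction u_ρ ∈ ∂K_ρ. -/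

import Mathlib

open Set MeasureTheory Filter Topology

/-- The Green's function `k(t,s) = (1/6)(3t²s − t³)` for `s ≥ t`,
`k(t,s) = (1/6)(3s²t − s³)` for `s ≤ t`. -/
noncomputable def kern (t s : ℝ) : ℝ :=
  if t ≤ s then (3 * t ^ 2 * s - t ^ 3) / 6 else (3 * s ^ 2 * t - s ^ 3) / 6

/-- `γ(t) = (1/6)(3t² − t³)`. -/
noncomputable def gam (t : ℝ) : ℝ := (3 * t ^ 2 - t ^ 3) / 6

/-- The sup norm over `[0,1]`: `‖w‖_∞ = sup_{t∈[0,1]} |w(t)|`. -/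
noncomputable def supN (w : ℝ → ℝ) : ℝ := ⨆ t : Icc (0:ℝ) 1, |w ↑t|

/-- The `C³[0,1]` norm `‖u‖₃ = max_{j=0,…,3} ‖u⁽ʲ⁾‖_∞`. -/
noncomputable def norm3 (u : ℝ → ℝ) : ℝ :=
  max (max (supN u) (supN (deriv u))) (max (supN (deriv^[2] u)) (supN (deriv^[3] u)))

/-- The cone `K = {u ∈ C³[0,1] : u, u′, u″, −u‴ ≥ 0 on [0,1]}`, where elements of
`C³[0,1]` are represented by three times continuously differentiable functions on `ℝ`. -/
def coneK : Set (ℝ → ℝ) :=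
  {u | ContDiff ℝ 3 u ∧ ∀ t ∈ Icc (0:ℝ) 1,
    0 ≤ u t ∧ 0 ≤ deriv u t ∧ 0 ≤ deriv^[2] u t ∧ 0 ≤ -(deriv^[3] u t)}

/-- `K̄_ρ = {u ∈ K : ‖u‖₃ ≤ ρ}`. -/
def Kbar (ρ : ℝ) : Set (ℝ → ℝ) := {u ∈ coneK | norm3 u ≤ ρ}

/-- `∂K_ρ = {u ∈ K : ‖u‖₃ = ρ}`. -/
def Kbdry (ρ : ℝ) : Set (ℝ → ℝ) := {u ∈ coneK | norm3 u = ρ}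

/-- `Π_ρ = [0,1] × [0,ρ]³ × [−ρ,0]`. -/
def PiSet (ρ : ℝ) : Set (ℝ × ℝ × ℝ × ℝ × ℝ) :=
  {p | p.1 ∈ Icc (0:ℝ) 1 ∧ p.2.1 ∈ Icc 0 ρ ∧ p.2.2.1 ∈ Icc 0 ρ ∧
       p.2.2.2.1 ∈ Icc 0 ρ ∧ p.2.2.2.2 ∈ Icc (-ρ) 0}

/-- The operator `Tu(t) = γ(t)H[u] + ∫₀¹ k(t,s) f(s, u(s), u′(s), u″(s), u‴(s)) ds`. -/
noncomputable def Toper (f : ℝ × ℝ × ℝ × ℝ × ℝ → ℝ) (H : (ℝ → ℝ) → ℝ) (u : ℝ → ℝ) :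
    ℝ → ℝ :=
  fun t => gam t * H u +
    ∫ s in (0:ℝ)..1, kern t s * f (s, u s, deriv u s, deriv^[2] u s, deriv^[3] u s)

/-- Continuity of a functional `H` on a subset `S` of `C³[0,1]` with respect to `‖·‖₃`. -/
def ContOn3 (H : (ℝ → ℝ) → ℝ) (S : Set (ℝ → ℝ)) : Prop :=
  ∀ u ∈ S, ∀ ε > (0:ℝ), ∃ δ > (0:ℝ), ∀ v ∈ S, norm3 (u - v) < δ → |H u - H v| < ε

/-- Boundedness of a functional `H` on a subset `S` of `C³[0,1]`. -/
def BddOn3 (H : (ℝ → ℝ) → ℝ) (S : Set (ℝ → ℝ)) : Prop :=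
  ∃ M : ℝ, ∀ u ∈ S, |H u| ≤ M

section Scarf

variable {ι X : Type*} [Fintype ι] [DecidableEq ι] [Fintype X] [DecidableEq X]

/-- A finite set `σ` is dominant for the rankings `v i` if no point lies strictly above the
minimum of `σ` in every ranking. -/
def IsDominant (v : ι → X → ℕ) (σ : Finset X) : Prop :=
  ∀ y, ∃ i, ∀ x ∈ σ, v i y ≤ v i x

omit [Fintype ι] [DecidableEq ι] [Fintype X] [DecidableEq X] in
theorem IsDominant.mono {v : ι → X → ℕ} {σ τ : Finset X} (h : IsDominant v σ) (hτ : τ ⊆ σ) :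
    IsDominant v τ := fun y => (h y).imp fun _ hi x hx => hi x (hτ hx)

open Classical in
/-- The points strictly above the minimum of `τ` in every ranking other than the `a`-th one. -/
noncomputable def aboveExcept (v : ι → X → ℕ) (τ : Finset X) (a : ι) : Finset X :=
  {x | ∀ k ≠ a, ∃ z ∈ τ, v k z < v k x}

open Classical in
/-- The points whose insertion in `τ` gives a strictly larger dominant set. -/
noncomputable def extensions (v : ι → X → ℕ) (τ : Finset X) : Finset X :=
  {x | x ∉ τ ∧ IsDominant v (insert x τ)}

theorem insert_isDominant_of_max {v : ι → X → ℕ} {τ : Finset X} (hτ : IsDominant v τ) {a : ι}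
    {x : X} (hx : x ∈ aboveExcept v τ a) (hmax : ∀ y ∈ aboveExcept v τ a, v a y ≤ v a x) :
    IsDominant v (insert x τ) := by
  classical
  simp only [aboveExcept, Finset.mem_filter, Finset.mem_univ, true_and] at hx hmax
  intro y
  by_cases hy : ∀ k ≠ a, ∃ z ∈ τ, v k z < v k y
  · obtain ⟨l, hl⟩ := hτ y
    have hla : l = a := by
      by_contra hne
      obtain ⟨z, hz, hlt⟩ := hy l hne
      exact absurd (hl z hz) (not_le.mpr hlt)
    subst hla
    refine ⟨l, fun z hz => ?_⟩
    rcases Finset.mem_insert.mp hz with rfl | hz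
    · exact hmax y hy
    · exact hl z hz
  · push Not at hy
    obtain ⟨k, hka, hk⟩ := hy
    refine ⟨k, fun z hz => ?_⟩
    rcases Finset.mem_insert.mp hz with rfl | hz
    · obtain ⟨w, hw, hlt⟩ := hx k hka
      exact (hk w hw).trans hlt.le
    · exact hk z hz

section Door

variable {v : ι → X → ℕ} {τ : Finset X} {m : ι → X} {i j : ι}

omit [Fintype X] [DecidableEq X] in
theorem minimizer_injOn (hcard : τ.card + 1 = Fintype.card ι) (hm : ∀ k, m k ∈ τ) {a : ι}
    (hsurj : ∀ z ∈ τ, ∃ k ≠ a, m k = z) {k l : ι} (hk : k ≠ a) (hl : l ≠ a) (h : m k = m l) :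
    k = l := by
  refine Finset.inj_on_of_surj_on_of_card_le (s := Finset.univ.erase a) (t := τ)
    (fun k _ => m k) (fun k _ => hm k) ?_ ?_ (by simp [hk]) (by simp [hl]) h
  · intro z hz
    obtain ⟨k, hk, rfl⟩ := hsurj z hz
    exact ⟨k, by simp [hk], rfl⟩
  · rw [Finset.card_erase_of_mem (Finset.mem_univ _), Finset.card_univ]
    omega

variable (hv : ∀ i, Function.Injective (v i)) (hτ : IsDominant v τ)
  (hcard : τ.card + 1 = Fintype.card ι) (hm : ∀ k, m k ∈ τ)
  (hmin : ∀ k, ∀ z ∈ τ, v k (m k) ≤ v k z) (hij : i ≠ j) (hmij : m i = m j)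

include hv hτ hm hmin hij hmij

omit [DecidableEq ι] [Fintype ι] [Fintype X] [DecidableEq X] in
theorem exists_minimizer_ne {a : ι} (ha : a = i ∨ a = j) {z : X} (hz : z ∈ τ) :
    ∃ k ≠ a, m k = z := by
  obtain ⟨k, hk⟩ := hτ z
  have hkz : m k = z := hv k (le_antisymm (hmin k z hz) (hk _ (hm k)))
  by_cases hka : k = a
  · rcases ha with rfl | rfl
    · exact ⟨j, hij.symm, by rw [← hmij, ← hka, hkz]⟩
    · exact ⟨i, hij, by rw [hmij, ← hka, hkz]⟩
  · exact ⟨k, hka, hkz⟩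

omit [DecidableEq X] in
theorem not_mem_of_mem_aboveExcept {a : ι} (ha : a = i ∨ a = j) {x : X}
    (hx : x ∈ aboveExcept v τ a) : x ∉ τ := by
  intro hxτ
  obtain ⟨k, hka, rfl⟩ := exists_minimizer_ne hv hτ hm hmin hij hmij ha hxτ
  simp only [aboveExcept, Finset.mem_filter, Finset.mem_univ, true_and] at hx
  obtain ⟨z, hz, hlt⟩ := hx k hka
  exact absurd (hmin k z hz) (not_le.mpr hlt)

include hcard

omit hτ in
theorem exists_max_of_mem_extensions {x : X} (hx : x ∈ extensions v τ) :
    ∃ a, (a = i ∨ a = j) ∧ x ∈ aboveExcept v τ a ∧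
      ∀ y ∈ aboveExcept v τ a, v a y ≤ v a x := by
  classical
  simp only [extensions, Finset.mem_filter, Finset.mem_univ, true_and] at hx
  obtain ⟨hxτ, hdom⟩ := hx
  obtain ⟨a, ha⟩ := hdom x
  have hne : ∀ k, v k x ≠ v k (m k) := fun k h => hxτ (by rw [hv k h]; exact hm k)
  have hxa : v a x < v a (m a) := lt_of_le_of_ne (ha _ (by simp [hm])) (hne a)
  have hsurj : ∀ z ∈ τ, ∃ k, k ≠ a ∧ m k = z ∧ v k z ≤ v k x := by
    intro z hz
    obtain ⟨k, hk⟩ := hdom z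
    have hkz : m k = z := hv k (le_antisymm (hmin k z hz) (hk _ (by simp [hm])))
    refine ⟨k, ?_, hkz, hk x (by simp)⟩
    rintro rfl
    have := hk x (by simp)
    rw [← hkz] at this
    omega
  have hinj : ∀ {k l}, k ≠ a → l ≠ a → m k = m l → k = l := fun hk hl h =>
    minimizer_injOn hcard hm
      (fun z hz => (hsurj z hz).imp fun k hk => ⟨hk.1, hk.2.1⟩) hk hl h
  refine ⟨a, ?_, ?_, ?_⟩
  · by_contra! hcon
    exact hij (hinj hcon.1.symm hcon.2.symm hmij)
  · simp only [aboveExcept, Finset.mem_filter, Finset.mem_univ, true_and]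
    intro k hka
    refine ⟨m k, hm k, ?_⟩
    obtain ⟨l, hla, hlk, hle⟩ := hsurj (m k) (hm k)
    obtain rfl := hinj hla hka hlk
    exact lt_of_le_of_ne hle (hne l).symm
  · intro y hy
    simp only [aboveExcept, Finset.mem_filter, Finset.mem_univ, true_and] at hy
    obtain ⟨l, hl⟩ := hdom y
    have hla : l = a := by
      by_contra hne
      obtain ⟨z, hz, hlt⟩ := hy l hne
      exact absurd (hl z (by simp [hz])) (not_le.mpr hlt)
    subst hla
    exact hl x (by simp)

open Classical in
theorem card_extensions :
    (extensions v τ).card = (if (aboveExcept v τ i).Nonempty then 1 else 0) +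
      (if (aboveExcept v τ j).Nonempty then 1 else 0) := by
  set N : ι → Finset X := fun a =>
    (aboveExcept v τ a).filter fun x => ∀ y ∈ aboveExcept v τ a, v a y ≤ v a x with hN
  have hNcard : ∀ a, (N a).card = if (aboveExcept v τ a).Nonempty then 1 else 0 := by
    intro a
    split_ifs with h
    · obtain ⟨x, hx, hmax⟩ := Finset.exists_max_image _ (v a) h
      rw [Finset.card_eq_one]
      refine ⟨x, ?_⟩
      ext y
      simp only [hN, Finset.mem_filter, Finset.mem_singleton]
      constructor
      · rintro ⟨hy, hymax⟩
        exact hv a (le_antisymm (hmax y hy) (hymax x hx))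
      · rintro rfl
        exact ⟨hx, hmax⟩
    · rw [Finset.not_nonempty_iff_eq_empty] at h
      simp [hN, h]
  have hunion : extensions v τ = N i ∪ N j := by
    ext x
    constructor
    · intro hx
      obtain ⟨a, ha, hxa, hmax⟩ :=
        exists_max_of_mem_extensions hv hcard hm hmin hij hmij hx
      rcases ha with rfl | rfl
      · exact Finset.mem_union_left _ (Finset.mem_filter.mpr ⟨hxa, hmax⟩)
      · exact Finset.mem_union_right _ (Finset.mem_filter.mpr ⟨hxa, hmax⟩)
    · intro hx
      obtain ⟨a, ha, hxa⟩ : ∃ a, (a = i ∨ a = j) ∧ x ∈ N a := by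
        rcases Finset.mem_union.mp hx with h | h
        · exact ⟨i, Or.inl rfl, h⟩
        · exact ⟨j, Or.inr rfl, h⟩
      obtain ⟨hxa, hmax⟩ := Finset.mem_filter.mp hxa
      simp only [extensions, Finset.mem_filter, Finset.mem_univ, true_and]
      exact ⟨not_mem_of_mem_aboveExcept hv hτ hm hmin hij hmij ha hxa,
        insert_isDominant_of_max hτ hxa hmax⟩
  have hdisj : Disjoint (N i) (N j) := by
    rw [Finset.disjoint_left]
    intro x hxi hxj
    have hxi := (Finset.mem_filter.mp hxi).1
    have hxj := (Finset.mem_filter.mp hxj).1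
    simp only [aboveExcept, Finset.mem_filter, Finset.mem_univ, true_and] at hxi hxj
    obtain ⟨l, hl⟩ := hτ x
    obtain ⟨z, hz, hlt⟩ : ∃ z ∈ τ, v l z < v l x := by
      by_cases hli : l = i
      · exact hxj l (hli ▸ hij)
      · exact hxi l hli
    exact absurd (hl z hz) (not_le.mpr hlt)
  rw [hunion, Finset.card_union_of_disjoint hdisj, hNcard, hNcard]

end Door

omit [Fintype X] in
theorem even_card_of_image_ne_univ (c : X → ι) (i₀ : ι) {σ : Finset X}
    (hcard : σ.card = Fintype.card ι) (hσ : σ.image c ≠ Finset.univ) :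
    Even (σ.filter fun x => (σ.erase x).image c = Finset.univ.erase i₀).card := by
  rcases (σ.filter fun x => (σ.erase x).image c = Finset.univ.erase i₀).eq_empty_or_nonempty
    with h | ⟨x, hx⟩
  · simp [h]
  obtain ⟨hxσ, hx⟩ := Finset.mem_filter.mp hx
  have hcx : c x ≠ i₀ := by
    intro h
    apply hσ
    rw [← Finset.insert_erase hxσ, Finset.image_insert, hx, h,
      Finset.insert_erase (Finset.mem_univ _)]
  have hinj : Set.InjOn c (σ.erase x) := by
    apply Finset.card_image_iff.mp
    rw [hx, Finset.card_erase_of_mem (Finset.mem_univ _), Finset.card_univ,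
      Finset.card_erase_of_mem hxσ, hcard]
  have hmem : c x ∈ (σ.erase x).image c := by rw [hx]; simp [hcx]
  obtain ⟨x', hx', hcx'⟩ := Finset.mem_image.mp hmem
  have hne : x' ≠ x := Finset.ne_of_mem_erase hx'
  have hx'σ : x' ∈ σ := Finset.mem_of_mem_erase hx'
  have hset : (σ.filter fun x => (σ.erase x).image c = Finset.univ.erase i₀) = {x, x'} := by
    ext z
    simp only [Finset.mem_filter, Finset.mem_insert, Finset.mem_singleton]
    constructor
    · rintro ⟨hzσ, hz⟩
      by_contra! hcon
      have hzx : z ∈ σ.erase x := Finset.mem_erase.mpr ⟨hcon.1, hzσ⟩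
      have : c z ∈ Finset.univ.erase i₀ := by rw [← hx]; exact Finset.mem_image_of_mem _ hzx
      rw [← hz] at this
      obtain ⟨w, hw, hwz⟩ := Finset.mem_image.mp this
      obtain ⟨hwz', hwσ⟩ := Finset.mem_erase.mp hw
      by_cases hwx : w = x
      · subst hwx
        exact hcon.2 (hinj hzx hx' (by rw [← hwz, hcx']))
      · exact hwz' (hinj (Finset.mem_erase.mpr ⟨hwx, hwσ⟩) hzx hwz)
    · rintro (rfl | rfl)
      · exact ⟨hxσ, hx⟩
      · refine ⟨hx'σ, ?_⟩
        rw [← hx]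
        have h1 : σ.erase z = insert x ((σ.erase x).erase z) := by
          rw [Finset.erase_right_comm, Finset.insert_erase]
          exact Finset.mem_erase.mpr ⟨hne.symm, hxσ⟩
        conv_rhs => rw [← Finset.insert_erase hx']
        rw [h1, Finset.image_insert, Finset.image_insert, hcx']
  rw [hset, Finset.card_pair hne.symm]
  exact even_two

theorem exists_dominant_image_eq_univ [Nontrivial ι] {v : ι → X → ℕ}
    (hv : ∀ i, Function.Injective (v i)) (E : ι → X)
    (hE : ∀ i x, v i (E i) ≤ v i x)
    (hE' : ∀ i k, k ≠ i → ∀ x ∉ Set.range E, v i x < v i (E k))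
    (hX : ∃ t, t ∉ Set.range E) (c : X → ι) (hc : ∀ i, c (E i) = i) :
    ∃ σ : Finset X, IsDominant v σ ∧ σ.card = Fintype.card ι ∧ σ.image c = Finset.univ := by
  classical
  by_contra! hcon
  obtain ⟨t, ht⟩ := hX
  obtain ⟨i₀⟩ := (inferInstance : Nonempty ι)
  have hEinj : Function.Injective E := fun a b h => by rw [← hc a, h, hc]
  set S : Finset (Finset X) := {σ | IsDominant v σ ∧ σ.card = Fintype.card ι}
  set D : Finset (Finset X) := {τ | IsDominant v τ ∧ τ.image c = Finset.univ.erase i₀ ∧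
    τ.card + 1 = Fintype.card ι}
  set P : Finset (Finset X × X) := D.sigma (fun τ => extensions v τ) |>.map
    (Equiv.sigmaEquivProd _ _).toEmbedding
  have hPD : P.card = ∑ τ ∈ D, (extensions v τ).card := by simp [P]
  set Q : Finset (Finset X × X) := S.sigma (fun σ => σ.filter fun x =>
    (σ.erase x).image c = Finset.univ.erase i₀) |>.map (Equiv.sigmaEquivProd _ _).toEmbedding
  have hQS : Q.card = ∑ σ ∈ S, (σ.filter fun x =>
    (σ.erase x).image c = Finset.univ.erase i₀).card := by simp [Q]
  have hPQ : P.card = Q.card := by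
    refine Finset.card_bij' (fun p _ => (insert p.2 p.1, p.2)) (fun p _ => (p.1.erase p.2, p.2))
      ?_ ?_ ?_ ?_
    · rintro ⟨τ, x⟩ h
      simp [P, D, extensions] at h
      simp [Q, S, h]
    · rintro ⟨σ, x⟩ h
      simp [Q, S] at h
      simp [P, D, extensions, h]
      refine ⟨h.1.1.mono (Finset.erase_subset _ _), ?_⟩
      rw [← h.1.2, Nat.sub_add_cancel (Finset.card_pos.mpr ⟨x, h.2.1⟩)]
    · rintro ⟨τ, x⟩ h
      simp [P, D, extensions] at h
      simp [h]
    · rintro ⟨σ, x⟩ h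
      simp [Q, S] at h
      simp [h]
  have hQeven : Even Q.card := by
    rw [hQS]
    refine Finset.even_sum _ fun σ hσ => ?_
    simp only [S, Finset.mem_filter, Finset.mem_univ, true_and] at hσ
    exact even_card_of_image_ne_univ c i₀ hσ.2 (hcon σ hσ.1 hσ.2)
  set τ₀ : Finset X := (Finset.univ.erase i₀).image E
  have hmemτ₀ : ∀ z, z ∈ τ₀ ↔ ∃ k ≠ i₀, E k = z := by simp [τ₀]
  have hcard₀ : τ₀.card + 1 = Fintype.card ι := by
    rw [Finset.card_image_of_injective _ hEinj, Finset.card_erase_of_mem (Finset.mem_univ _),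
      Finset.card_univ, Nat.sub_add_cancel Fintype.card_pos]
  have hτ₀ : IsDominant v τ₀ := by
    intro y
    by_cases hy : ∃ k ≠ i₀, E k = y
    · obtain ⟨k, -, rfl⟩ := hy
      exact ⟨k, fun x _ => hE k x⟩
    · refine ⟨i₀, fun x hx => ?_⟩
      obtain ⟨k, hk, rfl⟩ := (hmemτ₀ x).mp hx
      by_cases hy' : y ∈ Set.range E
      · obtain ⟨l, rfl⟩ := hy'
        by_cases hl : l = i₀
        · subst hl; exact hE _ _
        · exact absurd ⟨l, hl, rfl⟩ hy
      · exact (hE' i₀ k hk y hy').le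
  have hτ₀D : τ₀ ∈ D := by
    simp only [D, Finset.mem_filter, Finset.mem_univ, true_and]
    refine ⟨hτ₀, ?_, hcard₀⟩
    ext k
    simp [τ₀, Finset.image_image, Function.comp_def, hc]
  have hone : (extensions v τ₀).card = 1 := by
    obtain ⟨q, hq⟩ := exists_ne i₀
    obtain ⟨z, hz, hzmin⟩ := Finset.exists_min_image τ₀ (v i₀) ⟨E q, (hmemτ₀ _).mpr ⟨q, hq, rfl⟩⟩
    obtain ⟨p, hp, rfl⟩ := (hmemτ₀ z).mp hz
    set m : ι → X := fun k => if k = i₀ then E p else E k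
    have hm : ∀ k, m k ∈ τ₀ := by
      intro k
      by_cases hk : k = i₀
      · simpa [m, hk] using hz
      · simpa [m, hk] using (hmemτ₀ (E k)).mpr ⟨k, hk, rfl⟩
    have hmin : ∀ k, ∀ z ∈ τ₀, v k (m k) ≤ v k z := by
      intro k z hz
      by_cases hk : k = i₀
      · subst hk; simpa [m] using hzmin z hz
      · simpa [m, hk] using hE k z
    rw [card_extensions hv hτ₀ hcard₀ hm hmin hp.symm (by simp [m]), if_pos, if_neg]
    · rintro ⟨y, hy⟩
      simp only [aboveExcept, Finset.mem_filter, Finset.mem_univ, true_and] at hy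
      obtain ⟨z, hz, hlt⟩ := hy i₀ hp.symm
      have hlt : v i₀ (E p) < v i₀ y := (hzmin z hz).trans_lt hlt
      by_cases hy' : y ∈ Set.range E
      · obtain ⟨k, rfl⟩ := hy'
        by_cases hkp : k = p
        · subst hkp; exact lt_irrefl _ hlt
        · obtain ⟨z, -, hlt⟩ := hy k hkp
          exact absurd (hE k z) (not_le.mpr hlt)
      · exact absurd (hE' i₀ p hp y hy') (not_lt.mpr hlt.le)
    · refine ⟨t, ?_⟩
      simp only [aboveExcept, Finset.mem_filter, Finset.mem_univ, true_and]
      intro k hk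
      exact ⟨E k, (hmemτ₀ _).mpr ⟨k, hk, rfl⟩,
        lt_of_le_of_ne (hE k t) fun h => ht ⟨k, hv k h⟩⟩
  have htwo : ∀ τ ∈ D.erase τ₀, (extensions v τ).card = 2 := by
    intro τ hτ
    obtain ⟨hne, hτ⟩ := Finset.mem_erase.mp hτ
    simp only [D, Finset.mem_filter, Finset.mem_univ, true_and] at hτ
    obtain ⟨hdom, himg, hcard⟩ := hτ
    obtain ⟨s, hsτ, hs⟩ : ∃ s ∈ τ, s ∉ Set.range E := by
      by_contra! hsub
      apply hne
      apply Finset.eq_of_subset_of_card_le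
      · intro z hz
        obtain ⟨k, rfl⟩ := hsub z hz
        have : c (E k) ∈ Finset.univ.erase i₀ := himg ▸ Finset.mem_image_of_mem c hz
        rw [hc] at this
        exact Finset.mem_image_of_mem _ this
      · omega
    choose m hm hmin using fun k => Finset.exists_min_image τ (v k) ⟨s, hsτ⟩
    obtain ⟨i, -, j, -, hij, hmij⟩ := Finset.exists_ne_map_eq_of_card_lt_of_maps_to
      (s := Finset.univ) (t := τ) (f := m) (by rw [Finset.card_univ]; omega) (fun k _ => hm k)
    have hne : ∀ a, (aboveExcept v τ a).Nonempty := by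
      intro a
      refine ⟨E a, ?_⟩
      simp only [aboveExcept, Finset.mem_filter, Finset.mem_univ, true_and]
      exact fun k hk => ⟨s, hsτ, hE' k a hk.symm s hs⟩
    rw [card_extensions hv hdom hcard hm hmin hij hmij, if_pos (hne i), if_pos (hne j)]
  rw [← hPQ, hPD, ← Finset.add_sum_erase _ _ hτ₀D, hone,
    Finset.sum_congr rfl htwo, Finset.sum_const, smul_eq_mul, mul_comm] at hQeven
  grind

end Scarf

section Brouwer

variable {ι : Type*} [Fintype ι]

/-- The points of the simplex with coordinates in `ℕ / N`, scaled by `N`. -/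
abbrev SimplexGrid (ι : Type*) [Fintype ι] (N : ℕ) : Type _ :=
  {p : ι → Fin (N + 1) // ∑ i, (p i : ℕ) = N}

namespace SimplexGrid

variable {N : ℕ}

/-- The point of the standard simplex represented by a grid point. -/
noncomputable def toPoint (p : SimplexGrid ι N) : ι → ℝ := fun i => (p.1 i : ℕ) / (N : ℝ)

theorem toPoint_mem (hN : 0 < N) (p : SimplexGrid ι N) : p.toPoint ∈ stdSimplex ℝ ι := by
  refine ⟨fun i => by unfold toPoint; positivity, ?_⟩
  have : (N : ℝ) ≠ 0 := by positivity
  simp only [toPoint]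
  rw [← Finset.sum_div, ← Nat.cast_sum, p.2, div_self this]

variable [DecidableEq ι]

/-- The `i`-th coordinate as a rank on the grid together with one ideal point for each `k`,
which is lowest in the `k`-th ranking and highest in the other ones. -/
def rank (i : ι) : SimplexGrid ι N ⊕ ι → ℕ
  | Sum.inl p => p.1 i + 1
  | Sum.inr k => if k = i then 0 else N + 2

/-- The rank `SimplexGrid.rank` with ties broken. -/
noncomputable def strictRank (i : ι) (x : SimplexGrid ι N ⊕ ι) : ℕ :=
  rank i x * Fintype.card (SimplexGrid ι N ⊕ ι) + Fintype.equivFin _ x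

theorem strictRank_injective (i : ι) :
    Function.Injective (strictRank i : SimplexGrid ι N ⊕ ι → ℕ) := by
  intro x y h
  have h := congrArg (· % Fintype.card (SimplexGrid ι N ⊕ ι)) h
  simp only [strictRank, Nat.mul_add_mod_self_right, Nat.mod_eq_of_lt (Fin.is_lt _)] at h
  exact (Fintype.equivFin _).injective (Fin.ext h)

theorem strictRank_lt {i : ι} {x y : SimplexGrid ι N ⊕ ι} (h : rank i x < rank i y) :
    strictRank i x < strictRank i y := by
  have := (Fintype.equivFin _ x).is_lt
  have := Nat.mul_le_mul_right (Fintype.card (SimplexGrid ι N ⊕ ι)) (Nat.succ_le_of_lt h)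
  rw [Nat.succ_mul] at this
  unfold strictRank
  omega

theorem rank_le {i : ι} {x y : SimplexGrid ι N ⊕ ι} (h : strictRank i x ≤ strictRank i y) :
    rank i x ≤ rank i y := by
  by_contra! hlt
  exact absurd (strictRank_lt hlt) (not_lt.mpr h)

end SimplexGrid

theorem exists_sum_eq_and_le {C : Finset ι} (hC : C.Nonempty) {b : ι → ℕ} {N : ℕ}
    (h : ∑ i ∈ C, b i ≤ N) : ∃ p : SimplexGrid ι N, ∀ i ∈ C, b i ≤ p.1 i := by
  classical
  obtain ⟨j, hj⟩ := hC
  set q : ι → ℕ := fun i => (if i ∈ C then b i else 0) + if i = j then N - ∑ i ∈ C, b i else 0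
  have hq : ∑ i, q i = N := by
    simp only [q, Finset.sum_add_distrib, Finset.sum_ite_mem, Finset.univ_inter,
      Finset.sum_ite_eq', Finset.mem_univ, if_true]
    omega
  have hle : ∀ i, q i < N + 1 := fun i =>
    Nat.lt_succ_of_le (hq ▸ Finset.single_le_sum (f := q) (by simp) (Finset.mem_univ i))
  refine ⟨⟨fun i => ⟨q i, hle i⟩, hq⟩, fun i hi => ?_⟩
  simp [q, hi]

open SimplexGrid in
theorem exists_grid_cluster [DecidableEq ι] [Nontrivial ι] {N : ℕ}
    (c : SimplexGrid ι N → ι) :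
    ∃ (a : ι → ℕ) (q₀ : SimplexGrid ι N), (∀ i, a i ≤ q₀.1 i ∧ q₀.1 i ≤ a i + Fintype.card ι) ∧
      ∀ i, a i = 0 ∨ ∃ q : SimplexGrid ι N, c q = i ∧
        ∀ k, a k ≤ q.1 k ∧ q.1 k ≤ a k + Fintype.card ι := by
  obtain ⟨j⟩ := (inferInstance : Nonempty ι)
  obtain ⟨p₀, -⟩ := exists_sum_eq_and_le (N := N) (b := fun _ : ι => 0)
    (Finset.singleton_nonempty j) (by simp)
  obtain ⟨σ, hdom, -, himg⟩ := exists_dominant_image_eq_univ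
    (v := (strictRank : ι → SimplexGrid ι N ⊕ ι → ℕ)) strictRank_injective Sum.inr
    (by
      intro i x
      by_contra! h
      have := rank_le h.le
      rcases x with p | k
      · simp [rank] at this
      · by_cases hk : k = i
        · subst hk; exact lt_irrefl _ h
        · simp [rank, hk] at this)
    (by
      rintro i k hk (p | l) hx
      · apply strictRank_lt
        simp only [rank, hk, if_false]
        have := (p.1 i).is_lt
        omega
      · simp at hx)
    ⟨Sum.inl p₀, by simp⟩ (Sum.elim c id) (by simp)
  have hnot : ∀ p : SimplexGrid ι N, ∃ i, Sum.inr i ∉ σ ∧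
      ∀ q, Sum.inl q ∈ σ → p.1 i ≤ q.1 i := by
    intro p
    obtain ⟨i, hi⟩ := hdom (Sum.inl p)
    refine ⟨i, fun hmem => ?_, fun q hq => ?_⟩
    · have := rank_le (hi _ hmem)
      simp [rank] at this
    · have := rank_le (hi _ hq)
      simp only [rank] at this
      exact Fin.le_def.mpr (by omega)
  have hcol : ∀ i, Sum.inr i ∉ σ → ∃ q, Sum.inl q ∈ σ ∧ c q = i := by
    intro i hi
    obtain ⟨x, hx, hxi⟩ := Finset.mem_image.mp (himg ▸ Finset.mem_univ i)
    rcases x with q | k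
    · exact ⟨q, hx, hxi⟩
    · obtain rfl : k = i := hxi
      exact absurd hx hi
  set C : Finset ι := {i | Sum.inr i ∉ σ} with hC
  have hmemC : ∀ i, i ∈ C ↔ Sum.inr i ∉ σ := by simp [hC]
  have hCne : C.Nonempty := (hnot p₀).imp fun i hi => (hmemC i).mpr hi.1
  obtain ⟨i₁, hi₁⟩ := hCne
  obtain ⟨q₀, hq₀, -⟩ := hcol i₁ ((hmemC _).mp hi₁)
  choose m hm hmin using fun i => Finset.exists_min_image
    ({q | Sum.inl q ∈ σ} : Finset (SimplexGrid ι N)) (fun q => (q.1 i : ℕ)) ⟨q₀, by simpa using hq₀⟩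
  simp only [Finset.mem_filter, Finset.mem_univ, true_and] at hm hmin
  have hsum : N < ∑ i ∈ C, (((m i).1 i : ℕ) + 1) := by
    by_contra! hle
    obtain ⟨p, hp⟩ := exists_sum_eq_and_le ⟨i₁, hi₁⟩ hle
    obtain ⟨i, hi, hpi⟩ := hnot p
    have h1 := hp i ((hmemC i).mpr hi)
    have h2 := Fin.le_def.mp (hpi (m i) (hm i))
    omega
  set a : ι → ℕ := fun i => if i ∈ C then ((m i).1 i : ℕ) else 0 with ha
  have haN : N ≤ ∑ i, a i + Fintype.card ι := by
    rw [Finset.sum_add_distrib] at hsum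
    have h1 : ∑ i, a i = ∑ i ∈ C, ((m i).1 i : ℕ) := by simp [ha, Finset.sum_ite_mem]
    have h2 : ∑ i ∈ C, 1 ≤ Fintype.card ι := by simpa using Finset.card_le_univ C
    omega
  have hclose : ∀ q, Sum.inl q ∈ σ → ∀ k, a k ≤ q.1 k ∧ q.1 k ≤ a k + Fintype.card ι := by
    intro q hq
    have hle : ∀ k, a k ≤ q.1 k := by
      intro k
      by_cases hk : k ∈ C
      · simpa [ha, hk] using hmin k q hq
      · simp [ha, hk]
    refine fun k => ⟨hle k, ?_⟩
    have h1 := q.2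
    rw [← Finset.add_sum_erase _ _ (Finset.mem_univ k)] at h1 haN
    have h2 := Finset.sum_le_sum fun i (_ : i ∈ Finset.univ.erase k) => hle i
    omega
  refine ⟨a, q₀, hclose q₀ hq₀, fun i => ?_⟩
  by_cases hi : i ∈ C
  · obtain ⟨q, hq, hqi⟩ := hcol i ((hmemC i).mp hi)
    exact Or.inr ⟨q, hqi, hclose q hq⟩
  · exact Or.inl (by simp [ha, hi])

theorem exists_approx_fixedPoint_stdSimplex [Nontrivial ι] {F : (ι → ℝ) → ι → ℝ}
    (hF : MapsTo F (stdSimplex ℝ ι) (stdSimplex ℝ ι)) {N : ℕ} (hN : 0 < N) :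
    ∃ x ∈ stdSimplex ℝ ι, ∀ i, ∃ y ∈ stdSimplex ℝ ι,
      (∀ k, |y k - x k| ≤ Fintype.card ι / (N : ℝ)) ∧ x i - Fintype.card ι / (N : ℝ) ≤ F y i := by
  classical
  have hN' : (0 : ℝ) < N := by exact_mod_cast hN
  have hcol : ∀ q : SimplexGrid ι N, ∃ i, q.toPoint i ≤ F q.toPoint i := by
    intro q
    by_contra! hlt
    obtain ⟨j⟩ := (inferInstance : Nonempty ι)
    have := Finset.sum_lt_sum_of_nonempty ⟨j, Finset.mem_univ j⟩ fun i _ => hlt i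
    rw [(q.toPoint_mem hN).2, (hF (q.toPoint_mem hN)).2] at this
    exact lt_irrefl _ this
  choose c hc using hcol
  obtain ⟨a, q₀, hq₀, h⟩ := exists_grid_cluster c
  have hcast : ∀ (q : SimplexGrid ι N) k,
      a k ≤ q.1 k ∧ q.1 k ≤ a k + Fintype.card ι →
      (a k : ℝ) / N ≤ q.toPoint k ∧ q.toPoint k ≤ a k / N + Fintype.card ι / N := by
    intro q k hk
    rw [SimplexGrid.toPoint, ← add_div]
    constructor
    · gcongr
      exact_mod_cast hk.1
    · gcongr
      exact_mod_cast hk.2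
  refine ⟨q₀.toPoint, q₀.toPoint_mem hN, fun i => ?_⟩
  rcases h i with hai | ⟨q, hqi, hq⟩
  · refine ⟨q₀.toPoint, q₀.toPoint_mem hN, fun k => by simp; positivity, ?_⟩
    have h1 := (hcast q₀ i (hq₀ i)).2
    have h2 := (hF (q₀.toPoint_mem hN)).1 i
    simp only [hai, Nat.cast_zero, zero_div] at h1
    linarith
  · refine ⟨q.toPoint, q.toPoint_mem hN, fun k => ?_, ?_⟩
    · have h1 := hcast q₀ k (hq₀ k)
      have h2 := hcast q k (hq k)
      rw [abs_le]
      constructor <;> linarith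
    · have h1 := hcast q₀ i (hq₀ i)
      have h2 := hcast q i (hq i)
      have h3 := hc q
      rw [hqi] at h3
      linarith

/-- **Brouwer's fixed point theorem** on the standard simplex. -/
theorem exists_fixedPoint_stdSimplex [Nonempty ι] {F : (ι → ℝ) → ι → ℝ}
    (hFc : ContinuousOn F (stdSimplex ℝ ι)) (hF : MapsTo F (stdSimplex ℝ ι) (stdSimplex ℝ ι)) :
    ∃ x ∈ stdSimplex ℝ ι, F x = x := by
  classical
  rcases subsingleton_or_nontrivial ι with hι | hι
  · obtain ⟨j⟩ := (inferInstance : Nonempty ι)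
    have huniq : ∀ x ∈ stdSimplex ℝ ι, x = fun _ => 1 := by
      intro x hx
      ext i
      have := hx.2
      rwa [Fintype.sum_subsingleton _ i] at this
    have hmem := single_mem_stdSimplex ℝ j
    exact ⟨_, hmem, by rw [huniq _ hmem]; exact huniq _ (hF (huniq _ hmem ▸ hmem))⟩
  choose x hx y hy hxy hle using
    fun n : ℕ => exists_approx_fixedPoint_stdSimplex hF (Nat.succ_pos n)
  obtain ⟨x', hx', φ, hφ, hlim⟩ := (isCompact_stdSimplex ℝ ι).tendsto_subseq hx
  have herr : Tendsto (fun n => (Fintype.card ι : ℝ) / ((φ n).succ : ℕ)) atTop (𝓝 0) := by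
    have := (tendsto_const_div_atTop_nhds_zero_nat (Fintype.card ι : ℝ)).comp
      (tendsto_add_atTop_nat 1)
    exact this.comp hφ.tendsto_atTop
  rw [tendsto_pi_nhds] at hlim
  have hylim : ∀ i, Tendsto (fun n => y (φ n) i) atTop (𝓝 x') := by
    intro i
    rw [tendsto_pi_nhds]
    intro k
    have h1 : Tendsto (fun n => y (φ n) i k - x (φ n) k) atTop (𝓝 0) :=
      squeeze_zero_norm (fun n => hxy (φ n) i k) herr
    simpa using h1.add (hlim k)
  have hge : ∀ i, x' i ≤ F x' i := by
    intro i
    have h1 : Tendsto (fun n => F (y (φ n) i)) atTop (𝓝 (F x')) :=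
      (hFc x' hx').tendsto.comp (tendsto_nhdsWithin_iff.mpr
        ⟨hylim i, Eventually.of_forall fun n => hy (φ n) i⟩)
    have h2 := (hlim i).sub herr
    rw [sub_zero] at h2
    exact le_of_tendsto_of_tendsto' h2 ((tendsto_pi_nhds.mp h1) i) fun n => hle (φ n) i
  refine ⟨x', hx', ?_⟩
  have hsum : ∑ i, x' i = ∑ i, F x' i := by rw [hx'.2, (hF hx').2]
  ext i
  exact ((Finset.sum_eq_sum_iff_of_le fun i _ => hge i).mp hsum i (Finset.mem_univ i)).symm

end Brouwer

section Schauder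

variable {E : Type*} [NormedAddCommGroup E] [NormedSpace ℝ E] {K : Set E}

theorem exists_dist_map_self_le (hK : IsCompact K) (hconv : Convex ℝ K) (hne : K.Nonempty)
    {F : E → E} (hFc : ContinuousOn F K) (hF : MapsTo F K K) {ε : ℝ} (hε : 0 < ε) :
    ∃ x ∈ K, dist (F x) x ≤ ε := by
  obtain ⟨t, htK, htfin, hcover⟩ := hK.finite_cover_balls hε
  have : Fintype t := htfin.fintype
  have hpos : ∀ x ∈ K, 0 < ∑ i : t, max 0 (ε - dist x i) := by
    intro x hx
    obtain ⟨i, hi, hxi⟩ := mem_iUnion₂.mp (hcover hx)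
    refine Finset.sum_pos' (fun _ _ => le_max_left _ _) ⟨⟨i, hi⟩, Finset.mem_univ _, ?_⟩
    exact lt_max_of_lt_right (sub_pos.mpr hxi)
  have : Nonempty t := by
    obtain ⟨x, hx⟩ := hne
    obtain ⟨i, hi, -⟩ := mem_iUnion₂.mp (hcover hx)
    exact ⟨⟨i, hi⟩⟩
  set comb : (t → ℝ) → E := fun d => ∑ i, d i • (i : E) with hcomb
  have hcombK : ∀ d ∈ stdSimplex ℝ t, comb d ∈ K := fun d hd =>
    hconv.sum_mem (fun i _ => hd.1 i) hd.2 fun i _ => htK i.2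
  have hcombc : Continuous comb := by fun_prop
  set G : (t → ℝ) → t → ℝ := fun d i =>
    max 0 (ε - dist (F (comb d)) i) / ∑ j : t, max 0 (ε - dist (F (comb d)) j) with hG
  have hFcomb : ContinuousOn (fun d => F (comb d)) (stdSimplex ℝ t) :=
    hFc.comp hcombc.continuousOn hcombK
  have hw : ∀ i : t, ContinuousOn (fun d => max 0 (ε - dist (F (comb d)) i)) (stdSimplex ℝ t) :=
    fun i => continuousOn_const.sup (continuousOn_const.sub (continuous_dist.comp_continuousOn
      (hFcomb.prodMk continuousOn_const)))
  obtain ⟨d, hd, hfix⟩ := exists_fixedPoint_stdSimplex (F := G) (by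
      refine continuousOn_pi.mpr fun i =>
        (hw i).div (continuousOn_finsetSum _ fun j _ => hw j) ?_
      exact fun d hd => (hpos _ (hF (hcombK d hd))).ne') (by
      intro d hd
      have := hpos _ (hF (hcombK d hd))
      refine ⟨fun i => div_nonneg (le_max_left _ _) this.le, ?_⟩
      simp only [hG]
      rw [← Finset.sum_div, div_self this.ne'])
  refine ⟨comb d, hcombK d hd, ?_⟩
  rw [dist_eq_norm]
  have heq : F (comb d) - comb d = ∑ i, d i • (F (comb d) - (i : E)) := by
    simp only [smul_sub, Finset.sum_sub_distrib, ← Finset.sum_smul, hd.2, one_smul, hcomb]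
  calc ‖F (comb d) - comb d‖ ≤ ∑ i, d i * ε := by
        rw [heq]
        refine norm_sum_le_of_le _ fun i _ => ?_
        rw [norm_smul, Real.norm_of_nonneg (hd.1 i)]
        by_cases hi : dist (F (comb d)) i ≤ ε
        · rw [← dist_eq_norm]
          exact mul_le_mul_of_nonneg_left hi (hd.1 i)
        · have : d i = 0 := by
            rw [← hfix]
            simp only [hG]
            rw [max_eq_left (by linarith), zero_div]
          simp [this]
    _ = ε := by rw [← Finset.sum_mul, hd.2, one_mul]

/-- **Schauder's fixed point theorem** for compact convex sets. -/
theorem IsCompact.exists_fixedPoint_of_convex (hK : IsCompact K) (hconv : Convex ℝ K)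
    (hne : K.Nonempty) {F : E → E} (hFc : ContinuousOn F K) (hF : MapsTo F K K) :
    ∃ x ∈ K, F x = x := by
  obtain ⟨x, hx, hmin⟩ := hK.exists_isMinOn hne (continuous_dist.comp_continuousOn
    (hFc.prodMk continuousOn_id))
  refine ⟨x, hx, dist_le_zero.mp (le_of_forall_pos_le_add fun ε hε => ?_)⟩
  obtain ⟨y, hy, hyε⟩ := exists_dist_map_self_le hK hconv hne hFc hF hε
  rw [zero_add]
  exact (hmin hy).trans hyε

end Schauder

section Cantilever

/-- The solution of `u‴ = -w`, `u(0) = u′(0) = u″(1) = 0`. -/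
noncomputable def cantilever (w : ℝ → ℝ) (t : ℝ) : ℝ :=
  ∫ r in (0:ℝ)..t, ∫ s in (0:ℝ)..r, ∫ x in s..1, w x

variable {w g : ℝ → ℝ}

theorem hasDerivAt_integral_right (hw : Continuous w) (a t : ℝ) :
    HasDerivAt (fun t => ∫ s in a..t, w s) (w t) t :=
  (hw.integral_hasStrictDerivAt a t).hasDerivAt

theorem hasDerivAt_integral_left (hw : Continuous w) (b t : ℝ) :
    HasDerivAt (fun t => ∫ s in t..b, w s) (-w t) t := by
  simpa only [intervalIntegral.integral_symm b] using! (hasDerivAt_integral_right hw b t).neg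

theorem continuous_integral_left (hw : Continuous w) (b : ℝ) :
    Continuous fun t => ∫ s in t..b, w s :=
  continuous_iff_continuousAt.mpr fun t => (hasDerivAt_integral_left hw b t).continuousAt

theorem continuous_integral_right (hw : Continuous w) (a : ℝ) :
    Continuous fun t => ∫ s in a..t, w s :=
  continuous_iff_continuousAt.mpr fun t => (hasDerivAt_integral_right hw a t).continuousAt

theorem deriv_cantilever (hw : Continuous w) :
    deriv (cantilever w) = fun t => ∫ s in (0:ℝ)..t, ∫ x in s..1, w x :=
  funext fun t => (hasDerivAt_integral_right
    (continuous_integral_right (continuous_integral_left hw 1) 0) 0 t).deriv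

theorem deriv_iterate_two_cantilever (hw : Continuous w) :
    deriv^[2] (cantilever w) = fun t => ∫ x in t..1, w x := by
  change deriv (deriv (cantilever w)) = _
  rw [deriv_cantilever hw]
  exact funext fun t => (hasDerivAt_integral_right (continuous_integral_left hw 1) 0 t).deriv

theorem deriv_iterate_three_cantilever (hw : Continuous w) :
    deriv^[3] (cantilever w) = fun t => -w t := by
  change deriv (deriv^[2] (cantilever w)) = _
  rw [deriv_iterate_two_cantilever hw]
  exact funext fun t => (hasDerivAt_integral_left hw 1 t).deriv

theorem contDiff_cantilever (hw : Continuous w) : ContDiff ℝ 3 (cantilever w) := by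
  rw [show (3 : WithTop ℕ∞) = 1 + 1 + 1 by norm_num, contDiff_succ_iff_deriv,
    deriv_cantilever hw, contDiff_succ_iff_deriv, contDiff_one_iff_deriv]
  have h2 : deriv (fun t => ∫ s in (0:ℝ)..t, ∫ x in s..1, w x) = fun t => ∫ x in t..1, w x := by
    rw [← deriv_cantilever hw]
    exact deriv_iterate_two_cantilever hw
  rw [h2]
  refine ⟨fun t => (hasDerivAt_integral_right (continuous_integral_right
    (continuous_integral_left hw 1) 0) 0 t).differentiableAt, by simp, fun t =>
    (hasDerivAt_integral_right (continuous_integral_left hw 1) 0 t).differentiableAt, by simp,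
    fun t => (hasDerivAt_integral_left hw 1 t).differentiableAt, ?_⟩
  rw [show deriv (fun t => ∫ x in t..1, w x) = fun t => -w t from
    funext fun t => (hasDerivAt_integral_left hw 1 t).deriv]
  exact hw.neg

theorem cantilever_sub {w' : ℝ → ℝ} (hw : Continuous w) (hw' : Continuous w') :
    cantilever w - cantilever w' = cantilever (w - w') := by
  ext t
  have h1 := continuous_integral_left hw 1
  have h1' := continuous_integral_left hw' 1
  have h2 := continuous_integral_right h1 0
  have h2' := continuous_integral_right h1' 0
  simp only [Pi.sub_apply, cantilever]
  rw [← intervalIntegral.integral_sub (h2.intervalIntegrable _ _) (h2'.intervalIntegrable _ _)]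
  congr 1; ext r
  rw [← intervalIntegral.integral_sub (h1.intervalIntegrable _ _) (h1'.intervalIntegrable _ _)]
  congr 1; ext s
  rw [intervalIntegral.integral_sub (hw.intervalIntegrable _ _) (hw'.intervalIntegrable _ _)]

theorem supN_le {C : ℝ} (h : ∀ t ∈ Icc (0:ℝ) 1, |w t| ≤ C) : supN w ≤ C := by
  have : Nonempty (Icc (0:ℝ) 1) := ⟨⟨0, by simp⟩⟩
  exact ciSup_le fun t => h t t.2

theorem le_supN {C t : ℝ} (h : ∀ t ∈ Icc (0:ℝ) 1, |w t| ≤ C) (ht : t ∈ Icc (0:ℝ) 1) :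
    |w t| ≤ supN w :=
  le_ciSup (f := fun t : Icc (0:ℝ) 1 => |w t|)
    ⟨C, by rintro _ ⟨t, rfl⟩; exact h t t.2⟩ ⟨t, ht⟩

theorem abs_integral_le_of_subinterval {C a b : ℝ} (hC : 0 ≤ C)
    (h : ∀ t ∈ Icc (0:ℝ) 1, |w t| ≤ C)
    (ha : a ∈ Icc (0:ℝ) 1) (hb : b ∈ Icc (0:ℝ) 1) : |∫ s in a..b, w s| ≤ C := by
  calc |∫ s in a..b, w s| ≤ C * |b - a| :=
        intervalIntegral.norm_integral_le_of_norm_le_const (f := w) fun x hx =>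
          h x (uIcc_subset_Icc ha hb (uIoc_subset_uIcc hx))
    _ ≤ C * 1 := by
        gcongr
        rw [abs_le]
        constructor <;> linarith [ha.1, ha.2, hb.1, hb.2]
    _ = C := mul_one C

theorem abs_cantilever_le {C : ℝ} (h : ∀ t ∈ Icc (0:ℝ) 1, |w t| ≤ C) :
    (∀ t ∈ Icc (0:ℝ) 1, |∫ x in t..1, w x| ≤ C) ∧
    (∀ t ∈ Icc (0:ℝ) 1, |∫ s in (0:ℝ)..t, ∫ x in s..1, w x| ≤ C) ∧
    (∀ t ∈ Icc (0:ℝ) 1, |cantilever w t| ≤ C) := by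
  have hC : 0 ≤ C := (abs_nonneg _).trans (h 0 (by simp))
  have h2 : ∀ t ∈ Icc (0:ℝ) 1, |∫ x in t..1, w x| ≤ C := fun t ht =>
    abs_integral_le_of_subinterval hC h ht (by simp)
  have h1 : ∀ t ∈ Icc (0:ℝ) 1, |∫ s in (0:ℝ)..t, ∫ x in s..1, w x| ≤ C := fun t ht =>
    abs_integral_le_of_subinterval hC h2 (by simp) ht
  exact ⟨h2, h1, fun t ht => abs_integral_le_of_subinterval hC h1 (by simp) ht⟩

theorem norm3_cantilever_le {C : ℝ} (hw : Continuous w) (h : ∀ t ∈ Icc (0:ℝ) 1, |w t| ≤ C) :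
    norm3 (cantilever w) ≤ C := by
  obtain ⟨h2, h1, h0⟩ := abs_cantilever_le h
  rw [norm3, deriv_cantilever hw, deriv_iterate_two_cantilever hw,
    deriv_iterate_three_cantilever hw]
  exact max_le (max_le (supN_le h0) (supN_le h1))
    (max_le (supN_le h2) (supN_le (by simpa using h)))

theorem cantilever_nonneg (h : ∀ t ∈ Icc (0:ℝ) 1, 0 ≤ w t) :
    (∀ t ∈ Icc (0:ℝ) 1, 0 ≤ ∫ x in t..1, w x) ∧
    (∀ t ∈ Icc (0:ℝ) 1, 0 ≤ ∫ s in (0:ℝ)..t, ∫ x in s..1, w x) ∧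
    (∀ t ∈ Icc (0:ℝ) 1, 0 ≤ cantilever w t) := by
  have h2 : ∀ t ∈ Icc (0:ℝ) 1, 0 ≤ ∫ x in t..1, w x := fun t ht =>
    intervalIntegral.integral_nonneg ht.2 fun x hx => h x ⟨ht.1.trans hx.1, hx.2⟩
  have h1 : ∀ t ∈ Icc (0:ℝ) 1, 0 ≤ ∫ s in (0:ℝ)..t, ∫ x in s..1, w x := fun t ht =>
    intervalIntegral.integral_nonneg ht.1 fun x hx => h2 x ⟨hx.1, hx.2.trans ht.2⟩
  exact ⟨h2, h1, fun t ht =>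
    intervalIntegral.integral_nonneg ht.1 fun x hx => h1 x ⟨hx.1, hx.2.trans ht.2⟩⟩

theorem cantilever_mem_Kbdry {ρ : ℝ} (hw : Continuous w)
    (h : ∀ t ∈ Icc (0:ℝ) 1, w t ∈ Icc 0 ρ) (h0 : w 0 = ρ) : cantilever w ∈ Kbdry ρ := by
  have habs : ∀ t ∈ Icc (0:ℝ) 1, |w t| ≤ ρ := fun t ht => by
    rw [abs_of_nonneg (h t ht).1]; exact (h t ht).2
  obtain ⟨h2, h1, h0'⟩ := cantilever_nonneg fun t ht => (h t ht).1
  refine ⟨⟨contDiff_cantilever hw, fun t ht => ?_⟩,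
    le_antisymm (norm3_cantilever_le hw habs) ?_⟩
  · rw [deriv_cantilever hw, deriv_iterate_two_cantilever hw, deriv_iterate_three_cantilever hw,
      neg_neg]
    exact ⟨h0' t ht, h1 t ht, h2 t ht, (h t ht).1⟩
  · have : |-w 0| ≤ supN (fun t => -w t) :=
      le_supN (w := fun t => -w t) (C := ρ) (by simpa using habs) (by simp)
    rw [norm3, deriv_iterate_three_cantilever hw]
    refine le_max_of_le_right (le_max_of_le_right (le_trans ?_ this))
    rw [abs_neg, h0]
    exact le_abs_self ρ

theorem cantilever_jet_mem_PiSet {ρ t : ℝ} (hw : Continuous w)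
    (h : ∀ t ∈ Icc (0:ℝ) 1, w t ∈ Icc 0 ρ) (ht : t ∈ Icc (0:ℝ) 1) :
    (t, cantilever w t, deriv (cantilever w) t, deriv^[2] (cantilever w) t,
      deriv^[3] (cantilever w) t) ∈ PiSet ρ := by
  have habs : ∀ t ∈ Icc (0:ℝ) 1, |w t| ≤ ρ := fun t ht => by
    rw [abs_of_nonneg (h t ht).1]; exact (h t ht).2
  obtain ⟨h2, h1, h0⟩ := cantilever_nonneg fun t ht => (h t ht).1
  obtain ⟨b2, b1, b0⟩ := abs_cantilever_le habs
  rw [deriv_cantilever hw, deriv_iterate_two_cantilever hw, deriv_iterate_three_cantilever hw]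
  exact ⟨ht, ⟨h0 t ht, (abs_le.mp (b0 t ht)).2⟩, ⟨h1 t ht, (abs_le.mp (b1 t ht)).2⟩,
    ⟨h2 t ht, (abs_le.mp (b2 t ht)).2⟩, neg_le_neg (h t ht).2, neg_nonpos.mpr (h t ht).1⟩

theorem cantilever_congr {w' : ℝ → ℝ} (h : EqOn w w' (Icc 0 1)) {t : ℝ}
    (ht : t ∈ Icc (0:ℝ) 1) : cantilever w t = cantilever w' t :=
  have h01 : (0:ℝ) ∈ Icc (0:ℝ) 1 := by simp
  intervalIntegral.integral_congr fun _ hr =>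
    intervalIntegral.integral_congr fun _ hs =>
      intervalIntegral.integral_congr fun _ hx =>
        h (uIcc_subset_Icc (uIcc_subset_Icc h01 (uIcc_subset_Icc h01 ht hr) hs) (by simp) hx)

theorem eq_of_hasDerivAt_eq {F G f : ℝ → ℝ} (hF : ∀ t, HasDerivAt F (f t) t)
    (hG : ∀ t, HasDerivAt G (f t) t) {a : ℝ} (ha : F a = G a) : F = G := by
  ext t
  have h : ∀ t, HasDerivAt (fun t => F t - G t) 0 t := fun t => by
    simpa using! (hF t).sub (hG t)
  have := is_const_of_deriv_eq_zero (fun t => (h t).differentiableAt) (fun t => (h t).deriv) t a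
  simp only [ha, sub_self] at this
  linarith

theorem integral_kern_mul (hg : Continuous g) {t : ℝ} (ht : t ∈ Icc (0:ℝ) 1) :
    ∫ s in (0:ℝ)..1, kern t s * g s =
      t / 2 * (∫ s in (0:ℝ)..t, s ^ 2 * g s) - (∫ s in (0:ℝ)..t, s ^ 3 * g s) / 6 +
      t ^ 2 / 2 * (∫ s in t..1, s * g s) - t ^ 3 / 6 * ∫ s in t..1, g s := by
  have hkl : ∀ s ∈ uIcc 0 t, kern t s * g s = (3 * s ^ 2 * t - s ^ 3) / 6 * g s := by
    intro s hs
    rw [uIcc_of_le ht.1] at hs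
    rw [kern]
    split_ifs with h
    · obtain rfl := le_antisymm h hs.2
      ring
    · rfl
  have hkr : ∀ s ∈ uIcc t 1, kern t s * g s = (3 * t ^ 2 * s - t ^ 3) / 6 * g s := by
    intro s hs
    rw [uIcc_of_le ht.2] at hs
    rw [kern, if_pos hs.1]
  have hil : IntervalIntegrable (fun s => kern t s * g s) volume 0 t :=
    ContinuousOn.intervalIntegrable (ContinuousOn.congr (by fun_prop) hkl)
  have hir : IntervalIntegrable (fun s => kern t s * g s) volume t 1 :=
    ContinuousOn.intervalIntegrable (ContinuousOn.congr (by fun_prop) hkr)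
  rw [← intervalIntegral.integral_add_adjacent_intervals hil hir,
    intervalIntegral.integral_congr hkl, intervalIntegral.integral_congr hkr]
  have hl : ∫ s in (0:ℝ)..t, (3 * s ^ 2 * t - s ^ 3) / 6 * g s =
      t / 2 * (∫ s in (0:ℝ)..t, s ^ 2 * g s) - (∫ s in (0:ℝ)..t, s ^ 3 * g s) / 6 := by
    rw [← intervalIntegral.integral_const_mul, ← intervalIntegral.integral_div,
      ← intervalIntegral.integral_sub (Continuous.intervalIntegrable (by fun_prop) _ _)
        (Continuous.intervalIntegrable (by fun_prop) _ _)]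
    congr 1; ext s; ring
  have hr : ∫ s in t..1, (3 * t ^ 2 * s - t ^ 3) / 6 * g s =
      t ^ 2 / 2 * (∫ s in t..1, s * g s) - t ^ 3 / 6 * ∫ s in t..1, g s := by
    rw [← intervalIntegral.integral_const_mul, ← intervalIntegral.integral_const_mul,
      ← intervalIntegral.integral_sub (Continuous.intervalIntegrable (by fun_prop) _ _)
        (Continuous.intervalIntegrable (by fun_prop) _ _)]
    congr 1; ext s; ring
  rw [hl, hr]
  ring

/-- The Green's function representation of the solution of `u⁽⁴⁾ = lam * g`,
`u(0) = u′(0) = u″(1) = 0`, `u‴(1) = -lam * c`. -/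
theorem cantilever_eq_green (hg : Continuous g) {c lam : ℝ}
    (hw : Continuous w) (hwg : ∀ t, w t = lam * (c + ∫ s in t..1, g s)) {t : ℝ}
    (ht : t ∈ Icc (0:ℝ) 1) :
    cantilever w t = lam * (gam t * c + ∫ s in (0:ℝ)..1, kern t s * g s) := by
  have hA2 := hasDerivAt_integral_right (w := fun s => s ^ 2 * g s) (by fun_prop) 0
  have hA3 := hasDerivAt_integral_right (w := fun s => s ^ 3 * g s) (by fun_prop) 0
  have hB1 := hasDerivAt_integral_left (w := fun s => s * g s) (by fun_prop) 1
  have hB0 := hasDerivAt_integral_left hg 1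
  have h2 : (fun t => ∫ x in t..1, w x) = fun t =>
      lam * ((1 - t) * c + ((∫ s in t..1, s * g s) - t * ∫ s in t..1, g s)) := by
    refine eq_of_hasDerivAt_eq (hasDerivAt_integral_left hw 1) (fun t => ?_) (a := 1) (by simp)
    refine HasDerivAt.congr_deriv (((((hasDerivAt_id' t).const_sub 1).mul_const c).add
      ((hB1 t).sub ((hasDerivAt_id' t).mul (hB0 t)))).const_mul lam) ?_
    rw [hwg]
    ring
  have h1 : (fun t => ∫ s in (0:ℝ)..t, ∫ x in s..1, w x) = fun t =>
      lam * ((t - t ^ 2 / 2) * c + ((∫ s in (0:ℝ)..t, s ^ 2 * g s) / 2 +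
        t * (∫ s in t..1, s * g s) - t ^ 2 / 2 * ∫ s in t..1, g s)) := by
    refine eq_of_hasDerivAt_eq
      (hasDerivAt_integral_right (continuous_integral_left hw 1) 0) (fun t => ?_) (a := 0) (by simp)
    refine HasDerivAt.congr_deriv (((((hasDerivAt_id' t).sub
      ((hasDerivAt_pow 2 t).div_const 2)).mul_const c).add
      ((((hA2 t).div_const 2).add ((hasDerivAt_id' t).mul (hB1 t))).sub
        (((hasDerivAt_pow 2 t).div_const 2).mul (hB0 t)))).const_mul lam) ?_
    rw [congrFun h2 t]
    push_cast
    ring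
  have h0 : cantilever w = fun t =>
      lam * (gam t * c + (t / 2 * (∫ s in (0:ℝ)..t, s ^ 2 * g s) -
        (∫ s in (0:ℝ)..t, s ^ 3 * g s) / 6 + t ^ 2 / 2 * (∫ s in t..1, s * g s) -
        t ^ 3 / 6 * ∫ s in t..1, g s)) := by
    refine eq_of_hasDerivAt_eq (hasDerivAt_integral_right (continuous_integral_right
      (continuous_integral_left hw 1) 0) 0) (fun t => ?_) (a := 0) (by simp [cantilever, gam])
    refine HasDerivAt.congr_deriv (((((((hasDerivAt_pow 2 t).const_mul 3).sub
      (hasDerivAt_pow 3 t)).div_const 6).mul_const c).add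
      ((((((hasDerivAt_id' t).div_const 2).mul (hA2 t)).sub ((hA3 t).div_const 6)).add
        (((hasDerivAt_pow 2 t).div_const 2).mul (hB1 t))).sub
        (((hasDerivAt_pow 3 t).div_const 6).mul (hB0 t)))).const_mul lam) ?_
    rw [congrFun h1 t]
    push_cast
    ring
  rw [integral_kern_mul hg ht]
  exact congrFun h0 t

end Cantilever

section Eigenvalue

theorem isCompact_lipschitz_subset (ρ L : ℝ) :
    IsCompact {w : C(Icc (0:ℝ) 1, ℝ) | w 0 = ρ ∧ (∀ t, w t ∈ Icc 0 ρ) ∧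
      ∀ s t, |w s - w t| ≤ L * dist s t} := by
  refine ArzelaAscoli.isCompact_of_equicontinuous _ ?_ ?_
  · have himg : ContinuousMap.toFun '' {w : C(Icc (0:ℝ) 1, ℝ) | w 0 = ρ ∧
        (∀ t, w t ∈ Icc 0 ρ) ∧ ∀ s t, |w s - w t| ≤ L * dist s t} =
        {w : Icc (0:ℝ) 1 → ℝ | w 0 = ρ ∧ (∀ t, w t ∈ Icc 0 ρ) ∧
          ∀ s t, |w s - w t| ≤ L * dist s t} := by
      ext w
      constructor
      · rintro ⟨v, hv, rfl⟩
        exact hv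
      · intro hw
        have hlip : LipschitzWith L.toNNReal w := LipschitzWith.of_dist_le_mul fun s t =>
          (hw.2.2 s t).trans (by gcongr; exact Real.le_coe_toNNReal L)
        exact ⟨⟨w, hlip.continuous⟩, hw, rfl⟩
    rw [himg]
    refine (isCompact_univ_pi fun _ : Icc (0:ℝ) 1 => isCompact_Icc (a := (0:ℝ)) (b := ρ)
      ).of_isClosed_subset ?_ fun w hw t _ => hw.2.1 t
    simp only [ofPred_and, ofPred_forall, mem_Icc]
    refine (isClosed_eq (by fun_prop) (by fun_prop)).inter (IsClosed.inter ?_ ?_)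
    · exact isClosed_iInter fun t => (isClosed_le (by fun_prop) (by fun_prop)).inter
        (isClosed_le (by fun_prop) (by fun_prop))
    · exact isClosed_iInter fun s => isClosed_iInter fun t =>
        isClosed_le (by fun_prop) (by fun_prop)
  · refine Metric.equicontinuous_of_continuity_modulus (fun d => L * d) ?_ _ fun s t w => ?_
    · simpa using (continuous_const_mul L).tendsto 0
    · exact w.2.2.2 s t

theorem convex_lipschitz_subset (ρ L : ℝ) :
    Convex ℝ {w : C(Icc (0:ℝ) 1, ℝ) | w 0 = ρ ∧ (∀ t, w t ∈ Icc 0 ρ) ∧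
      ∀ s t, |w s - w t| ≤ L * dist s t} := by
  rintro v ⟨hv0, hv1, hv2⟩ w ⟨hw0, hw1, hw2⟩ a b ha hb hab
  refine ⟨?_, fun t => convex_Icc 0 ρ (hv1 t) (hw1 t) ha hb hab, fun s t => ?_⟩
  · simp [hv0, hw0, ← add_mul, hab]
  · calc |(a • v + b • w) s - (a • v + b • w) t| = |a * (v s - v t) + b * (w s - w t)| := by
          simp only [ContinuousMap.add_apply, ContinuousMap.smul_apply, smul_eq_mul]
          ring_nf
      _ ≤ a * |v s - v t| + b * |w s - w t| := by
          refine (abs_add_le _ _).trans ?_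
          rw [abs_mul, abs_mul, abs_of_nonneg ha, abs_of_nonneg hb]
      _ ≤ a * (L * dist s t) + b * (L * dist s t) := by
          gcongr
          exacts [hv2 s t, hw2 s t]
      _ = L * dist s t := by rw [← add_mul, hab, one_mul]

theorem continuous_integral_left_of_uncurry {X : Type*} [TopologicalSpace X]
    [FirstCountableTopology X] {g : X → ℝ → ℝ} (hg : Continuous (Function.uncurry g)) (b : ℝ) :
    Continuous fun p : X × ℝ => ∫ s in p.2..b, g p.1 s := by
  have hg' : Continuous (Function.uncurry fun p : X × ℝ => g p.1) :=
    hg.comp (by fun_prop : Continuous fun q : (X × ℝ) × ℝ => (q.1.1, q.2))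
  simp only [intervalIntegral.integral_symm b]
  exact (intervalIntegral.continuous_parametric_intervalIntegral_of_continuous hg'
    continuous_snd).neg

theorem exists_eq_mul_add_integral {ρ M c₀ : ℝ} (hρ : 0 < ρ) (hM : 0 ≤ M) (hc₀ : 0 < c₀)
    {A : Set C(Icc (0:ℝ) 1, ℝ)} (hA : A = {w | w 0 = ρ ∧ ∀ t, w t ∈ Icc 0 ρ})
    {g : C(Icc (0:ℝ) 1, ℝ) → ℝ → ℝ} (hg : Continuous (Function.uncurry g))
    {h : C(Icc (0:ℝ) 1, ℝ) → ℝ} (hh : ContinuousOn h A)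
    (hgM : ∀ w ∈ A, ∀ s ∈ Icc (0:ℝ) 1, g w s ∈ Icc 0 M) (hh0 : ∀ w ∈ A, 0 ≤ h w)
    (hD : ∀ w ∈ A, c₀ ≤ h w + ∫ s in (0:ℝ)..1, g w s) :
    ∃ w ∈ A, ∃ lam > 0, ∀ t : Icc (0:ℝ) 1, w t = lam * (h w + ∫ s in (t:ℝ)..1, g w s) := by
  set L := ρ / c₀ * M with hL
  set K := {w : C(Icc (0:ℝ) 1, ℝ) | w 0 = ρ ∧ (∀ t, w t ∈ Icc 0 ρ) ∧
      ∀ s t, |w s - w t| ≤ L * dist s t} with hK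
  have hKA : K ⊆ A := by
    rw [hA]
    exact fun w hw => ⟨hw.1, hw.2.1⟩
  have hgc : ∀ w, Continuous (g w) := fun w => hg.comp (by fun_prop : Continuous fun s => (w, s))
  have hI := continuous_integral_left_of_uncurry hg 1
  let F : C(Icc (0:ℝ) 1, ℝ) → C(Icc (0:ℝ) 1, ℝ) := fun w =>
    ⟨fun t => ρ / (h w + ∫ s in (0:ℝ)..1, g w s) * (h w + ∫ s in (t:ℝ)..1, g w s), by
      have := continuous_integral_left (hgc w) 1
      fun_prop⟩
  have hFc : ContinuousOn F K := by
    refine ContinuousMap.continuousOn_of_continuousOn_uncurry _ ?_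
    have h1 : ContinuousOn (fun p : C(Icc (0:ℝ) 1, ℝ) × Icc (0:ℝ) 1 => h p.1)
        (K ×ˢ univ) := (hh.mono hKA).comp continuousOn_fst fun p hp => hp.1
    have h2 : Continuous fun p : C(Icc (0:ℝ) 1, ℝ) × Icc (0:ℝ) 1 =>
        ∫ s in (p.2:ℝ)..1, g p.1 s :=
      hI.comp (by fun_prop : Continuous fun p : C(Icc (0:ℝ) 1, ℝ) × Icc (0:ℝ) 1 =>
        (p.1, (p.2:ℝ)))
    have h3 : Continuous fun p : C(Icc (0:ℝ) 1, ℝ) × Icc (0:ℝ) 1 =>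
        ∫ s in (0:ℝ)..1, g p.1 s :=
      hI.comp (by fun_prop : Continuous fun p : C(Icc (0:ℝ) 1, ℝ) × Icc (0:ℝ) 1 =>
        (p.1, (0:ℝ)))
    exact (continuousOn_const.div (h1.add h3.continuousOn) fun p hp =>
      (hc₀.trans_le (hD _ (hKA hp.1))).ne').mul (h1.add h2.continuousOn)
  have hF : MapsTo F K K := by
    intro w hw
    have hwA := hKA hw
    have hDw := hD w hwA
    have hD0 := hc₀.trans_le hDw
    have hsplit : ∀ a b : ℝ, (∫ s in a..b, g w s) + ∫ s in b..1, g w s = ∫ s in a..1, g w s :=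
      fun a b => intervalIntegral.integral_add_adjacent_intervals
        ((hgc w).intervalIntegrable _ _) ((hgc w).intervalIntegrable _ _)
    refine ⟨?_, fun t => ⟨?_, ?_⟩, fun s t => ?_⟩
    · change ρ / (h w + ∫ s in (0:ℝ)..1, g w s) * (h w + ∫ s in (0:ℝ)..1, g w s) = ρ
      exact div_mul_cancel₀ _ hD0.ne'
    · refine mul_nonneg (by positivity) (add_nonneg (hh0 w hwA) ?_)
      exact intervalIntegral.integral_nonneg t.2.2 fun x hx =>
        (hgM w hwA x ⟨t.2.1.trans hx.1, hx.2⟩).1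
    · change ρ / (h w + ∫ s in (0:ℝ)..1, g w s) * (h w + ∫ s in (t:ℝ)..1, g w s) ≤ ρ
      rw [div_mul_eq_mul_div, div_le_iff₀ hD0]
      gcongr
      rw [← hsplit 0 t]
      have : 0 ≤ ∫ s in (0:ℝ)..t, g w s := intervalIntegral.integral_nonneg t.2.1 fun x hx =>
        (hgM w hwA x ⟨hx.1, hx.2.trans t.2.2⟩).1
      linarith
    · have heq : F w s - F w t =
          ρ / (h w + ∫ s in (0:ℝ)..1, g w s) * ∫ x in (s:ℝ)..t, g w x := by
        change ρ / (h w + ∫ s in (0:ℝ)..1, g w s) * (h w + ∫ s in (s:ℝ)..1, g w s) -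
          ρ / (h w + ∫ s in (0:ℝ)..1, g w s) * (h w + ∫ s in (t:ℝ)..1, g w s) = _
        rw [← hsplit s t]
        ring
      have hint : |∫ x in (s:ℝ)..t, g w x| ≤ M * dist s t := by
        rw [dist_comm]
        refine intervalIntegral.norm_integral_le_of_norm_le_const (f := g w) fun x hx => ?_
        have := hgM w hwA x (uIcc_subset_Icc s.2 t.2 (uIoc_subset_uIcc hx))
        rw [Real.norm_eq_abs, abs_of_nonneg this.1]
        exact this.2
      rw [heq, abs_mul, abs_of_pos (by positivity), hL, mul_assoc]
      gcongr
  obtain ⟨w, hw, hfix⟩ := (isCompact_lipschitz_subset ρ L).exists_fixedPoint_of_convex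
    (convex_lipschitz_subset ρ L)
    ⟨ContinuousMap.const _ ρ, rfl, fun _ => ⟨hρ.le, le_rfl⟩, fun s t => by
      have : 0 ≤ L := by positivity
      simpa using mul_nonneg this dist_nonneg⟩ hFc hF
  exact ⟨w, hKA hw, _, div_pos hρ (hc₀.trans_le (hD w (hKA hw))), fun t =>
    (DFunLike.congr_fun hfix t).symm⟩

theorem continuous_uncurry_IccExtend :
    Continuous (Function.uncurry fun (w : C(Icc (0:ℝ) 1, ℝ)) => IccExtend zero_le_one w) := by
  exact ContinuousEval.continuous_eval.comp (continuous_fst.prodMk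
    ((continuous_projIcc (h := zero_le_one)).comp continuous_snd))

theorem continuous_cantilever_jet :
    Continuous fun p : C(Icc (0:ℝ) 1, ℝ) × ℝ =>
      (p.2, cantilever (IccExtend zero_le_one p.1) p.2,
        deriv (cantilever (IccExtend zero_le_one p.1)) p.2,
        deriv^[2] (cantilever (IccExtend zero_le_one p.1)) p.2,
        deriv^[3] (cantilever (IccExtend zero_le_one p.1)) p.2) := by
  have hc : ∀ w : C(Icc (0:ℝ) 1, ℝ), Continuous (IccExtend zero_le_one w) :=
    fun w => w.continuous.Icc_extend'
  have hpair : Continuous (Function.uncurry fun (p : C(Icc (0:ℝ) 1, ℝ) × ℝ) (s : ℝ) =>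
      (p.1, s)) := by fun_prop
  have h3 := continuous_uncurry_IccExtend
  have h2 := continuous_integral_left_of_uncurry h3 1
  have h1 : Continuous fun p : C(Icc (0:ℝ) 1, ℝ) × ℝ =>
      ∫ s in (0:ℝ)..p.2, ∫ x in s..1, IccExtend zero_le_one p.1 x :=
    intervalIntegral.continuous_parametric_intervalIntegral_of_continuous
      (f := fun (p : C(Icc (0:ℝ) 1, ℝ) × ℝ) s => ∫ x in s..1, IccExtend zero_le_one p.1 x)
      (h2.comp hpair) continuous_snd
  have h0 : Continuous fun p : C(Icc (0:ℝ) 1, ℝ) × ℝ =>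
      cantilever (IccExtend zero_le_one p.1) p.2 :=
    intervalIntegral.continuous_parametric_intervalIntegral_of_continuous
      (f := fun (p : C(Icc (0:ℝ) 1, ℝ) × ℝ) r =>
        ∫ s in (0:ℝ)..r, ∫ x in s..1, IccExtend zero_le_one p.1 x)
      (h1.comp hpair) continuous_snd
  simp only [deriv_cantilever (hc _), deriv_iterate_two_cantilever (hc _),
    deriv_iterate_three_cantilever (hc _)]
  exact continuous_snd.prodMk (h0.prodMk (h1.prodMk (h2.prodMk h3.neg)))

theorem norm3_cantilever_IccExtend_sub_le (v w : C(Icc (0:ℝ) 1, ℝ)) :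
    norm3 (cantilever (IccExtend zero_le_one v) - cantilever (IccExtend zero_le_one w)) ≤
      dist v w := by
  have hv : Continuous (IccExtend zero_le_one v) := v.continuous.Icc_extend'
  have hw : Continuous (IccExtend zero_le_one w) := w.continuous.Icc_extend'
  rw [cantilever_sub hv hw]
  exact norm3_cantilever_le (hv.sub hw) fun t _ => ContinuousMap.dist_apply_le_dist (f := v) (g := w)
    (projIcc 0 1 zero_le_one _)

theorem isCompact_PiSet (ρ : ℝ) : IsCompact (PiSet ρ) :=
  isCompact_Icc.prod (isCompact_Icc.prod (isCompact_Icc.prod (isCompact_Icc.prod isCompact_Icc)))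

end Eigenvalue

/-- Theorem 2.2: under hypotheses (a), (b), (c) there exist a positive eigenvalue
`λ_ρ` and an eigenfunction `u_ρ ∈ ∂K_ρ` of the parameter-dependent cantilever BVP,
i.e. `u_ρ(t) = λ_ρ (γ(t)H[u_ρ] + ∫₀¹ k(t,s) f(s,u_ρ(s),u_ρ′(s),u_ρ″(s),u_ρ‴(s)) ds)`
on `[0,1]`. -/
theorem exists_eigenvalue_eigenfunction
    (ρ : ℝ) (hρ : 0 < ρ)
    (f : ℝ × ℝ × ℝ × ℝ × ℝ → ℝ) (hfc : ContinuousOn f (PiSet ρ))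
    (δlo : ℝ → ℝ) (hδc : ContinuousOn δlo (Icc 0 1))
    (hδ0 : ∀ t ∈ Icc (0:ℝ) 1, 0 ≤ δlo t)
    (hfδ : ∀ p ∈ PiSet ρ, δlo p.1 ≤ f p)
    (H : (ℝ → ℝ) → ℝ) (hHc : ContOn3 H (Kbar ρ)) (hHb : BddOn3 H (Kbar ρ))
    (η : ℝ) (hη0 : 0 ≤ η) (hHη : ∀ u ∈ Kbdry ρ, η ≤ H u)
    (hpos : 0 < η + ∫ s in (0:ℝ)..1, δlo s) :
    ∃ lam : ℝ, 0 < lam ∧ ∃ u ∈ Kbdry ρ,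
      ∀ t ∈ Icc (0:ℝ) 1, u t = lam * Toper f H u t := by
  obtain ⟨f', hf'⟩ := ContinuousMap.exists_restrict_eq (isCompact_PiSet ρ).isClosed
    ⟨(PiSet ρ).domRestrict f, hfc.domRestrict⟩
  replace hf' : EqOn f' f (PiSet ρ) := fun p hp => DFunLike.congr_fun hf' ⟨p, hp⟩
  obtain ⟨M, hM⟩ := (isCompact_PiSet ρ).exists_bound_of_continuousOn hfc
  set A := {w : C(Icc (0:ℝ) 1, ℝ) | w 0 = ρ ∧ ∀ t, w t ∈ Icc 0 ρ} with hA
  have hc : ∀ w : C(Icc (0:ℝ) 1, ℝ), Continuous (IccExtend zero_le_one w) :=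
    fun w => w.continuous.Icc_extend'
  have hIcc : ∀ w ∈ A, ∀ t ∈ Icc (0:ℝ) 1, IccExtend zero_le_one w t ∈ Icc 0 ρ :=
    fun w hw t _ => hw.2 _
  have hmem : ∀ w ∈ A, cantilever (IccExtend zero_le_one w) ∈ Kbdry ρ := fun w hw =>
    cantilever_mem_Kbdry (hc w) (hIcc w hw) (by
      rw [IccExtend_left]
      exact hw.1)
  let jet : C(Icc (0:ℝ) 1, ℝ) → ℝ → ℝ × ℝ × ℝ × ℝ × ℝ := fun w s =>
    (s, cantilever (IccExtend zero_le_one w) s,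
      deriv (cantilever (IccExtend zero_le_one w)) s,
      deriv^[2] (cantilever (IccExtend zero_le_one w)) s,
      deriv^[3] (cantilever (IccExtend zero_le_one w)) s)
  have hjet : ∀ w ∈ A, ∀ s ∈ Icc (0:ℝ) 1, jet w s ∈ PiSet ρ := fun w hw s hs =>
    cantilever_jet_mem_PiSet (hc w) (hIcc w hw) hs
  have hg : Continuous (Function.uncurry fun w s => f' (jet w s)) :=
    f'.continuous.comp continuous_cantilever_jet
  have hgw : ∀ w, Continuous fun s => f' (jet w s) := fun w =>
    hg.comp (by fun_prop : Continuous fun s => (w, s))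
  have hh : ContinuousOn (fun w : C(Icc (0:ℝ) 1, ℝ) =>
      H (cantilever (IccExtend zero_le_one w))) A := by
    refine Metric.continuousOn_iff.mpr fun w hw ε hε => ?_
    obtain ⟨d, hd, hHd⟩ := hHc _ ⟨(hmem w hw).1, (hmem w hw).2.le⟩ ε hε
    refine ⟨d, hd, fun v hv hvw => ?_⟩
    rw [dist_comm, Real.dist_eq]
    refine hHd _ ⟨(hmem v hv).1, (hmem v hv).2.le⟩ ?_
    rw [dist_comm] at hvw
    exact (norm3_cantilever_IccExtend_sub_le w v).trans_lt hvw
  have hlow : ∀ w ∈ A, ∀ s ∈ Icc (0:ℝ) 1, δlo s ≤ f' (jet w s) := fun w hw s hs => by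
    rw [hf' (hjet w hw s hs)]
    exact hfδ _ (hjet w hw s hs)
  obtain ⟨w, hw, lam, hlam, hfix⟩ := exists_eq_mul_add_integral (M := M) hρ
    ((norm_nonneg _).trans (hM (0, 0, 0, 0, 0) (by simp [PiSet, hρ.le]))) hpos hA hg hh
    (fun w hw s hs => ⟨(hδ0 s hs).trans (hlow w hw s hs), by
      rw [hf' (hjet w hw s hs)]
      exact (le_abs_self _).trans (hM _ (hjet w hw s hs))⟩)
    (fun w hw => hη0.trans (hHη _ (hmem w hw)))
    (fun w hw => add_le_add (hHη _ (hmem w hw)) (intervalIntegral.integral_mono_on zero_le_one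
      (hδc.intervalIntegrable_of_Icc zero_le_one) ((hgw w).intervalIntegrable _ _) (hlow w hw)))
  refine ⟨lam, hlam, _, hmem w hw, fun t ht => ?_⟩
  have heq : EqOn (IccExtend zero_le_one w) (fun t => lam *
      (H (cantilever (IccExtend zero_le_one w)) + ∫ s in t..1, f' (jet w s))) (Icc 0 1) :=
    fun s hs => by
      rw [IccExtend_of_mem _ _ hs]
      exact hfix ⟨s, hs⟩
  have hcont := continuous_integral_left (hgw w) 1
  rw [cantilever_congr heq ht, cantilever_eq_green (hgw w) (by fun_prop) (fun _ => rfl) ht, Toper]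
  congr 2
  refine intervalIntegral.integral_congr fun s hs => ?_
  rw [uIcc_of_le zero_le_one] at hs
  exact congrArg (kern t s * ·) (hf' (hjet w hw s hs))
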